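/- arXiv:math/0506066 — 2 statements merged into one kernel-verified Lean document; each statement's English description precedes it below -/
import Mathlib

section
/- Let A be a simple finitely generated K-algebra. Then for every nonzero finitely generated A-module M one has GK(M) ≥ GK(A) / (d(A) + max{d(A), 1}), where d stands for either the filter dimension fd or the left filter dimension lfd (the First Filter Inequality). -/
/- Common definitions: degree of a function, standard finite-dimensional filtrations,
Gelfand-Kirillov dimension, return functions and filter dimensions (V. Bavula,
"Filter dimension"), and the Rentschler–Gabriel (left) Krull dimension via deviation. -/

open Filter

noncomputable section

/-- The degree `γ(f)` (as an extended real) of a function `f : ℕ → ℕ∞`: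
`inf { r : ℝ | f i ≤ i ^ r for all sufficiently large i }` (`⊤` if no such `r` exists). -/
def gammaDeg (f : ℕ → ℕ∞) : EReal :=
  sInf { x : EReal | ∃ r : ℝ, x = (r : EReal) ∧
    ∀ᶠ i in atTop, f i ≤ (⌊(i : ℝ) ^ r⌋₊ : ℕ∞) }

/-- `V` is the degree-one piece of a standard finite-dimensional filtration `{A_i = V ^ i}`
of the `K`-algebra `A`: it is finite-dimensional, contains `1` and generates `A`
(this is the filtration associated with a finite set of algebra generators). -/
structure IsStdFilt (K A : Type) [Field K] [Ring A] [Algebra K A] (V : Submodule K A) :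
    Prop where
  one_mem : (1 : A) ∈ V
  fin : FiniteDimensional K V
  gen : Algebra.adjoin K (V : Set A) = ⊤

/-- The Gelfand-Kirillov dimension `GK(A) = γ(i ↦ dim A_i)` of the algebra `A` w.r.t. the
standard filtration `{A_i = V ^ i}`. -/
def gkAlg (K A : Type) [Field K] [Ring A] [Algebra K A] (V : Submodule K A) : EReal :=
  gammaDeg fun i => (Module.finrank K (V ^ i : Submodule K A) : ℕ∞)

/-- The `K`-subspace `p • W` of the module `M` spanned by products `a • w`, `a ∈ p`, `w ∈ W`. -/
def smulSub (K : Type) [Field K] {A M : Type} [Ring A] [Algebra K A] [AddCommGroup M]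
    [Module K M] [Module A M] [IsScalarTower K A M] (p : Submodule K A) (W : Submodule K M) :
    Submodule K M :=
  Submodule.span K {x : M | ∃ a ∈ p, ∃ w ∈ W, x = a • w}

/-- `W` is a finite-dimensional generating subspace of the `A`-module `M`. -/
def IsGenSub (K A : Type) {M : Type} [Field K] [Ring A] [Algebra K A] [AddCommGroup M]
    [Module K M] [Module A M] [IsScalarTower K A M] (W : Submodule K M) : Prop :=
  FiniteDimensional K W ∧ Submodule.span A (W : Set M) = ⊤

/-- The Gelfand-Kirillov dimension `GK(M) = γ(i ↦ dim M_i)` of the module `M` w.r.t. the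
standard filtration `{M_i = V ^ i • W}`. -/
def gkModW (K : Type) [Field K] {A M : Type} [Ring A] [Algebra K A] [AddCommGroup M]
    [Module K M] [Module A M] [IsScalarTower K A M] (V : Submodule K A) (W : Submodule K M) :
    EReal :=
  gammaDeg fun i => (Module.finrank K (smulSub K (V ^ i) W) : ℕ∞)

/-- The Gelfand-Kirillov dimension of a module, as the infimum over all finite-dimensional
generating subspaces (it agrees with `gkModW` for each of them). -/
def gkMod (K A M : Type) [Field K] [Ring A] [Algebra K A] [AddCommGroup M] [Module K M]
    [Module A M] [IsScalarTower K A M] (V : Submodule K A) : EReal :=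
  ⨅ W : {W : Submodule K M // IsGenSub K A W}, gkModW K V W.1

/-- The return function `ν_{F,W}` of the `A`-module `M` associated with the standard
filtration `F = {V ^ i}` of `A` and the generating subspace `W` of `M`:
`ν(i) = min { j | V ^ j • N ⊇ W for every generating subspace N ⊆ V ^ i • W }`. -/
def retMod (K : Type) [Field K] {A M : Type} [Ring A] [Algebra K A] [AddCommGroup M]
    [Module K M] [Module A M] [IsScalarTower K A M] (V : Submodule K A) (W : Submodule K M)
    (i : ℕ) : ℕ∞ :=
  sInf { j : ℕ∞ | ∃ n : ℕ, j = (n : ℕ∞) ∧ ∀ N : Submodule K M,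
      Submodule.span A (N : Set M) = ⊤ → N ≤ smulSub K (V ^ i) W →
      W ≤ smulSub K (V ^ n) N }

/-- The filter dimension `fd(M) = γ(ν_{F,W})` of the `A`-module `M`. -/
def fdModW (K : Type) [Field K] {A M : Type} [Ring A] [Algebra K A] [AddCommGroup M]
    [Module K M] [Module A M] [IsScalarTower K A M] (V : Submodule K A) (W : Submodule K M) :
    EReal :=
  gammaDeg (retMod K V W)

/-- The return function `ν_F` of a (simple) algebra `A` w.r.t. the standard filtration
`F = {A_i = V ^ i}`: `ν_F(i) = min { j | 1 ∈ A_j a A_j for all 0 ≠ a ∈ A_i }`, where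
`A_j a A_j` is the `K`-span of `{ x * a * y | x, y ∈ A_j }`. -/
def nuFn (K : Type) [Field K] {A : Type} [Ring A] [Algebra K A] (V : Submodule K A)
    (i : ℕ) : ℕ∞ :=
  sInf { j : ℕ∞ | ∃ n : ℕ, j = (n : ℕ∞) ∧ ∀ a ∈ (V ^ i : Submodule K A), a ≠ 0 →
    (1 : A) ∈ Submodule.span K
      {x : A | ∃ u ∈ (V ^ n : Submodule K A), ∃ w ∈ (V ^ n : Submodule K A), x = u * a * w} }

/-- The left return function `λ_F` of a (simple) algebra `A`:
`λ_F(i) = min { j | 1 ∈ A a A_j for all 0 ≠ a ∈ A_i }`, where `A a A_j` is the left ideal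
of `A` generated by the set `a A_j`. -/
def lamFn (K : Type) [Field K] {A : Type} [Ring A] [Algebra K A] (V : Submodule K A)
    (i : ℕ) : ℕ∞ :=
  sInf { j : ℕ∞ | ∃ n : ℕ, j = (n : ℕ∞) ∧ ∀ a ∈ (V ^ i : Submodule K A), a ≠ 0 →
    (1 : A) ∈ Submodule.span A {x : A | ∃ w ∈ (V ^ n : Submodule K A), x = a * w} }

/-- The filter dimension `fd(A) = γ(ν_F)` of a simple finitely generated algebra `A`. -/
def fdAlg (K : Type) [Field K] {A : Type} [Ring A] [Algebra K A] (V : Submodule K A) : EReal :=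
  gammaDeg (nuFn K V)

/-- The left filter dimension `lfd(A) = γ(λ_F)` of a simple finitely generated algebra `A`. -/
def lfdAlg (K : Type) [Field K] {A : Type} [Ring A] [Algebra K A] (V : Submodule K A) : EReal :=
  gammaDeg (lamFn K V)

/-- `DevLE n α` : the deviation of the poset `α` is at most `n`. -/
def DevLE : ℕ → (α : Type) → [inst : Preorder α] → Prop
  | 0, α, _ => ∀ f : ℕ → α, Antitone f → ∀ᶠ i in atTop, ¬ f (i + 1) < f i
  | n + 1, α, _ => ∀ f : ℕ → α, Antitone f →
      ∀ᶠ i in atTop, DevLE n (Set.Icc (f (i + 1)) (f i))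

open Classical in
/-- The left Krull dimension in the sense of Rentschler–Gabriel of the `A`-module `M`:
the deviation of the poset of submodules of `M`, as an extended real (`⊥` for the zero
module, `⊤` if the deviation is not a natural number). For `M = A` this is the left Krull
dimension `K.dim A` of the ring `A`. -/
def kdimE (A M : Type) [Ring A] [AddCommGroup M] [Module A M] : EReal :=
  if Subsingleton M then ⊥
  else sInf { x : EReal | ∃ n : ℕ, x = (n : EReal) ∧ DevLE n (Submodule A M) }


theorem aux_gamma_lt {f : ℕ → ℕ∞} {r : ℝ} (h : gammaDeg f < (r : EReal)) :
    ∀ᶠ i in atTop, f i ≤ (⌊(i : ℝ) ^ r⌋₊ : ℕ∞) := by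
  obtain ⟨x, ⟨r', rfl, h'⟩, hlt⟩ := sInf_lt_iff.1 h
  have hlt' : r' < r := by exact_mod_cast hlt
  filter_upwards [h', eventually_ge_atTop 1] with i hi h1
  refine hi.trans ?_
  have h1' : (1 : ℝ) ≤ i := by exact_mod_cast h1
  exact_mod_cast Nat.floor_le_floor (Real.rpow_le_rpow_of_exponent_le h1' hlt'.le)

theorem aux_gamma_le {f : ℕ → ℕ∞} {r : ℝ}
    (h : ∀ᶠ i in atTop, f i ≤ (⌊(i : ℝ) ^ r⌋₊ : ℕ∞)) : gammaDeg f ≤ (r : EReal) :=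
  sInf_le ⟨r, rfl, h⟩

theorem aux_gamma_neg {f : ℕ → ℕ∞} (h : gammaDeg f < 0) : ∀ᶠ i in atTop, f i = 0 := by
  obtain ⟨x, ⟨r', rfl, h'⟩, hlt⟩ := sInf_lt_iff.1 h
  have hlt' : r' < 0 := by exact_mod_cast hlt
  filter_upwards [h', eventually_ge_atTop 2] with i hi h1
  have h1' : (1 : ℝ) < i := by exact_mod_cast h1
  have : ⌊(i : ℝ) ^ r'⌋₊ = 0 := Nat.floor_eq_zero.2 (Real.rpow_lt_one_of_one_lt_of_neg h1' hlt')
  rw [this] at hi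
  simpa using hi

theorem aux_gamma_bot {f : ℕ → ℕ∞} (h : gammaDeg f < 0) : gammaDeg f = ⊥ := by
  rw [EReal.eq_bot_iff_forall_lt]
  intro y
  refine lt_of_le_of_lt (aux_gamma_le (r := y - 1) ?_) (by exact_mod_cast sub_one_lt y)
  filter_upwards [aux_gamma_neg h] with i hi
  simp [hi]

section
variable {K A : Type} [Field K] [Ring A] [Algebra K A] {V : Submodule K A}
    {M : Type} [AddCommGroup M] [Module K M] [Module A M] [IsScalarTower K A M]
    {W : Submodule K M}

theorem aux_fin (hV : IsStdFilt K A V) (i : ℕ) : FiniteDimensional K (V ^ i : Submodule K A) := by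
  have := (Module.Finite.iff_fg (N := V)).1 hV.fin
  exact (Module.Finite.iff_fg).2 (this.pow i)

theorem aux_smul_fin (p : Submodule K A) (W : Submodule K M) (hp : FiniteDimensional K p)
    (hW : FiniteDimensional K W) : FiniteDimensional K (smulSub K p W) := by
  have : smulSub K p W = Submodule.map₂ (Algebra.lsmul K K M : A →ₐ[K] Module.End K M).toLinearMap p W := by
    rw [Submodule.map₂_eq_span_image2]
    unfold smulSub
    congr 1
    ext x
    constructor
    · rintro ⟨a, ha, w, hw, rfl⟩
      exact ⟨a, ha, w, hw, rfl⟩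
    · rintro ⟨a, ha, w, hw, rfl⟩
      exact ⟨a, ha, w, hw, rfl⟩
  rw [this]
  exact Module.Finite.iff_fg.2 (Submodule.FG.map₂ _ (Module.Finite.iff_fg.1 hp) (Module.Finite.iff_fg.1 hW))

theorem aux_mono (hV : IsStdFilt K A V) {i j : ℕ} (h : i ≤ j) : V ^ i ≤ V ^ j :=
  pow_le_pow_right' (Submodule.one_le.2 hV.one_mem) h

theorem aux_one_mem (hV : IsStdFilt K A V) (i : ℕ) : (1 : A) ∈ V ^ i := by
  have := aux_mono hV (Nat.zero_le i)
  exact this (by rw [pow_zero]; exact Submodule.one_le.1 le_rfl)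

theorem aux_W_ne [Nontrivial M] (hW : IsGenSub K A W) : ∃ w ∈ W, w ≠ 0 := by
  by_contra! h
  have : W = ⊥ := by
    rw [Submodule.eq_bot_iff]; exact h
  have h2 := hW.2
  rw [this] at h2
  simp at h2

theorem aux_pos [Nontrivial M] (hV : IsStdFilt K A V) (hW : IsGenSub K A W) (i : ℕ) :
    1 ≤ Module.finrank K (smulSub K (V ^ i) W) := by
  obtain ⟨w, hw, h0⟩ := aux_W_ne hW
  have hf := aux_smul_fin (V ^ i) W (aux_fin hV i) hW.1
  have : Nontrivial (smulSub K (V ^ i) W) :=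
    ⟨⟨⟨w, Submodule.subset_span ⟨1, aux_one_mem hV i, w, hw, by simp⟩⟩, 0, fun h => h0 (congrArg Subtype.val h)⟩⟩
  exact Module.finrank_pos

theorem aux_act {i j : ℕ} {a : A} (ha : a ∈ V ^ i) {x : M} (hx : x ∈ smulSub K (V ^ j) W) :
    a • x ∈ smulSub K (V ^ (i + j)) W := by
  unfold smulSub at hx
  induction hx using Submodule.span_induction with
  | mem x h =>
    obtain ⟨b, hb, w, hw, rfl⟩ := h
    refine Submodule.subset_span ⟨a * b, ?_, w, hw, by rw [mul_smul]⟩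
    rw [pow_add]
    exact Submodule.mul_mem_mul ha hb
  | zero => simp
  | add x y _ _ hx hy => rw [smul_add]; exact add_mem hx hy
  | smul c x _ hx => rw [smul_comm]; exact Submodule.smul_mem _ c hx

/-- the property defining lambda -/
def LamProp (V : Submodule K A) (i n : ℕ) : Prop :=
  ∀ a ∈ (V ^ i : Submodule K A), a ≠ 0 →
    (1 : A) ∈ Submodule.span A {x : A | ∃ w ∈ (V ^ n : Submodule K A), x = a * w}

theorem aux_dim [Nontrivial M] (hV : IsStdFilt K A V) (hW : IsGenSub K A W) {i n : ℕ}
    (h : LamProp V i n) :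
    Module.finrank K (V ^ i : Submodule K A) ≤
      Module.finrank K (smulSub K (V ^ n) W) * Module.finrank K (smulSub K (V ^ (i + n)) W) := by
  have hf := aux_smul_fin (V ^ n) W (aux_fin hV n) hW.1
  have hf' := aux_smul_fin (V ^ (i + n)) W (aux_fin hV (i + n)) hW.1
  rw [← Module.finrank_linearMap K K]
  let φ : (V ^ i : Submodule K A) →ₗ[K] (smulSub K (V ^ n) W →ₗ[K] smulSub K (V ^ (i + n)) W) :=
    { toFun := fun a =>
        { toFun := fun x => ⟨a.1 • x.1, aux_act a.2 x.2⟩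
          map_add' := fun x y => by ext; simp
          map_smul' := fun c x => by ext; exact smul_comm _ _ _ }
      map_add' := fun a b => by ext; simp [add_smul]
      map_smul' := fun c a => by ext; simp }
  apply LinearMap.finrank_le_finrank_of_injective (f := φ)
  rw [← LinearMap.ker_eq_bot, Submodule.eq_bot_iff]
  rintro ⟨a, ha⟩ hφ
  by_contra hne
  have hne' : a ≠ 0 := fun h => hne (by simpa using h)
  obtain ⟨w, hw, h0⟩ := aux_W_ne hW
  apply h0
  have key : ∀ y ∈ Submodule.span A {x : A | ∃ w ∈ (V ^ n : Submodule K A), x = a * w}, y • w = 0 := by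
    intro y hy
    induction hy using Submodule.span_induction with
    | mem x h =>
      obtain ⟨b, hb, rfl⟩ := h
      have := LinearMap.congr_fun (LinearMap.mem_ker.1 hφ)
        ⟨b • w, Submodule.subset_span ⟨b, hb, w, hw, rfl⟩⟩
      have := congrArg Subtype.val this
      rw [mul_smul]
      exact this
    | zero => simp
    | add x y _ _ hx hy => rw [add_smul, hx, hy, add_zero]
    | smul c x _ hx => rw [smul_eq_mul, mul_smul, hx, smul_zero]
  simpa using key 1 (h a ha hne')

theorem aux_lam_mono (hV : IsStdFilt K A V) {i m n : ℕ} (hmn : m ≤ n) (h : LamProp V i m) :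
    LamProp V i n := fun a ha h0 =>
  Submodule.span_mono (by rintro _ ⟨w, hw, e⟩; exact ⟨w, aux_mono hV hmn hw, e⟩) (h a ha h0)

theorem aux_lam (hV : IsStdFilt K A V) {i n : ℕ} (h : lamFn K V i ≤ n) : LamProp V i n := by
  unfold lamFn at h
  obtain ⟨x, ⟨m, rfl, hm⟩, hx⟩ := sInf_lt_iff.1
    (lt_of_le_of_lt h (by exact_mod_cast Nat.lt_succ_self n : (n : ℕ∞) < (n + 1 : ℕ)))
  have : m < n + 1 := by exact_mod_cast hx
  exact aux_lam_mono hV (by omega) hm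

theorem aux_nu (i : ℕ) : lamFn K V i ≤ nuFn K V i := by
  refine sInf_le_sInf ?_
  rintro _ ⟨n, rfl, h⟩
  refine ⟨n, rfl, fun a ha h0 => ?_⟩
  have := h a ha h0
  refine (Submodule.span_le (p := (Submodule.span A
    {x : A | ∃ w ∈ (V ^ n : Submodule K A), x = a * w}).restrictScalars K)).2 ?_ this
  rintro _ ⟨u, hu, w, hw, rfl⟩
  rw [mul_assoc]
  exact Submodule.smul_mem _ u (Submodule.subset_span ⟨w, hw, rfl⟩)

theorem aux_main [Nontrivial M] (hV : IsStdFilt K A V) (hW : IsGenSub K A W) {f : ℕ → ℕ∞}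
    (hf : ∀ i, lamFn K V i ≤ f i) {r s ε : ℝ} (hr : 0 < r) (hs : 0 < s) (hε : 0 < ε)
    (hfr : gammaDeg f < r) (hMs : gkModW K V W < s) :
    gkAlg K A V ≤ ((s * (r + max r 1) + ε : ℝ) : EReal) := by
  apply aux_gamma_le
  have h1 := aux_gamma_lt hfr
  have h2 := aux_gamma_lt hMs
  have t0 : Tendsto (fun i : ℕ => (i : ℝ) ^ r) atTop atTop :=
    (tendsto_rpow_atTop hr).comp tendsto_natCast_atTop_atTop
  have t1 : Tendsto (fun i : ℕ => ⌊(i : ℝ) ^ r⌋₊) atTop atTop := tendsto_nat_floor_atTop.comp t0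
  have t2 : Tendsto (fun i : ℕ => i + ⌊(i : ℝ) ^ r⌋₊) atTop atTop :=
    tendsto_atTop_mono (fun i => Nat.le_add_right _ _) tendsto_id
  have t3 : Tendsto (fun i : ℕ => (i : ℝ) ^ ε) atTop atTop :=
    (tendsto_rpow_atTop hε).comp tendsto_natCast_atTop_atTop
  filter_upwards [h1, t1.eventually h2, t2.eventually h2, t3.eventually_ge_atTop (2 ^ s),
    eventually_ge_atTop 1] with i a1 a2 a3 a4 a5
  set n := ⌊(i : ℝ) ^ r⌋₊ with hn
  have hi : (1 : ℝ) ≤ i := by exact_mod_cast a5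
  have hi0 : (0 : ℝ) < i := by linarith
  have hdim := aux_dim hV hW (aux_lam hV ((hf i).trans a1))
  have b2 := Nat.cast_le.1 a2
  have b3 := Nat.cast_le.1 a3
  rw [Nat.cast_le]
  apply Nat.le_floor
  have c2 := (Nat.le_floor_iff (by positivity)).1 b2
  have c3 := (Nat.le_floor_iff (by positivity)).1 b3
  have hnr : (n : ℝ) ≤ (i : ℝ) ^ r := Nat.floor_le (by positivity)
  have e2 : (n : ℝ) ^ s ≤ (i : ℝ) ^ (r * s) := by
    rw [Real.rpow_mul hi0.le]
    exact Real.rpow_le_rpow (by positivity) hnr hs.le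
  have e3 : ((i + n : ℕ) : ℝ) ^ s ≤ 2 ^ s * (i : ℝ) ^ (max r 1 * s) := by
    rw [Real.rpow_mul hi0.le, ← Real.mul_rpow (by norm_num) (by positivity)]
    apply Real.rpow_le_rpow (by positivity) _ hs.le
    push_cast
    have g1 : (i : ℝ) ^ r ≤ (i : ℝ) ^ (max r 1) :=
      Real.rpow_le_rpow_of_exponent_le hi (le_max_left _ _)
    have g2 : (i : ℝ) ^ (1 : ℝ) ≤ (i : ℝ) ^ (max r 1) :=
      Real.rpow_le_rpow_of_exponent_le hi (le_max_right _ _)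
    rw [Real.rpow_one] at g2
    linarith
  calc (Module.finrank K (V ^ i : Submodule K A) : ℝ)
      ≤ (Module.finrank K (smulSub K (V ^ n) W) : ℝ) *
        (Module.finrank K (smulSub K (V ^ (i + n)) W) : ℝ) := by exact_mod_cast hdim
    _ ≤ (i : ℝ) ^ (r * s) * (2 ^ s * (i : ℝ) ^ (max r 1 * s)) :=
        mul_le_mul (c2.trans e2) (c3.trans e3) (by positivity) (by positivity)
    _ ≤ (i : ℝ) ^ (r * s) * ((i : ℝ) ^ ε * (i : ℝ) ^ (max r 1 * s)) := by gcongr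
    _ = (i : ℝ) ^ (s * (r + max r 1) + ε) := by
        rw [← Real.rpow_add hi0, ← Real.rpow_add hi0]
        congr 1
        ring

end

theorem first_filter_inequality
    (K A : Type) [Field K] [Ring A] [Algebra K A] [IsSimpleRing A]
    (V : Submodule K A) (hV : IsStdFilt K A V)
    (M : Type) [AddCommGroup M] [Module K M] [Module A M] [IsScalarTower K A M]
    [Nontrivial M] [Module.Finite A M]
    (W : Submodule K M) (hW : IsGenSub K A W)
    (d : EReal) (hd : d = fdAlg K V ∨ d = lfdAlg K V) :
    gkAlg K A V / (d + max d 1) ≤ gkModW K V W := by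
  obtain ⟨f, hf, rfl⟩ : ∃ f : ℕ → ℕ∞, (∀ i, lamFn K V i ≤ f i) ∧ d = gammaDeg f := by
    rcases hd with h | h
    · exact ⟨_, aux_nu, h⟩
    · exact ⟨_, fun _ => le_rfl, h⟩
  have hM0 : 0 ≤ gkModW K V W := by
    by_contra! h
    obtain ⟨i, hi⟩ := (aux_gamma_neg h).exists
    have := aux_pos hV hW i
    have : Module.finrank K (smulSub K (V ^ i) W) = 0 := by exact_mod_cast hi
    omega
  rcases lt_or_ge (gammaDeg f) 0 with hneg | hd0
  · rw [aux_gamma_bot hneg]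
    simpa using hM0
  rcases eq_or_ne (gammaDeg f) ⊤ with htop | hdt
  · rw [htop]
    simpa using hM0
  rcases eq_or_ne (gkModW K V W) ⊤ with hMt | hMt
  · rw [hMt]; exact le_top
  have hbot : gammaDeg f ≠ ⊥ := fun h => by simp [h] at hd0
  have hMbot : gkModW K V W ≠ ⊥ := fun h => by simp [h] at hM0
  obtain ⟨d, hde⟩ : ∃ d : ℝ, gammaDeg f = d := ⟨_, (EReal.coe_toReal hdt hbot).symm⟩
  obtain ⟨m, hme⟩ : ∃ m : ℝ, gkModW K V W = m := ⟨_, (EReal.coe_toReal hMt hMbot).symm⟩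
  rw [hde] at hd0
  rw [hme] at hM0
  have hd0' : 0 ≤ d := by exact_mod_cast hd0
  have hm0' : 0 ≤ m := by exact_mod_cast hM0
  have hD : (gammaDeg f + max (gammaDeg f) 1 : EReal) = ((d + max d 1 : ℝ) : EReal) := by
    rw [hde, EReal.coe_add]
    congr 1
  have hDpos : 0 < d + max d 1 := by
    have := le_max_right d 1
    linarith
  rw [hD, hme, EReal.div_le_iff_le_mul (by exact_mod_cast hDpos) (EReal.coe_ne_top _),
    ← EReal.coe_mul]
  have hall : ∀ ε : ℝ, 0 < ε →
      gkAlg K A V ≤ (((m + ε) * ((d + ε) + max (d + ε) 1) + ε : ℝ) : EReal) := by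
    intro ε hε
    refine aux_main hV hW hf (by linarith) (by linarith) hε ?_ ?_
    · rw [hde]; exact_mod_cast (by linarith : d < d + ε)
    · rw [hme]; exact_mod_cast (by linarith : m < m + ε)
  have hc : Continuous fun ε : ℝ => (((m + ε) * ((d + ε) + max (d + ε) 1) + ε : ℝ) : EReal) :=
    continuous_coe_real_ereal.comp (by fun_prop)
  have ht := (hc.tendsto 0).mono_left (nhdsWithin_le_nhds (s := Set.Ioi 0))
  have := ge_of_tendsto ht (Filter.eventually_of_mem self_mem_nhdsWithin hall)
  refine this.trans (le_of_eq ?_)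
  congr 1
  simp [mul_comm]

end
end

section
/- Let A be a simple finitely generated K-algebra such that its centre Z(A) is an algebraic field extension of K, and let F = {A_i} be a standard finite-dimensional filtration of A. Then λ_F(i) ≤ ν_F(i) < ∞ for all i ≥ 0. -/
/- Common definitions: degree of a function, standard finite-dimensional filtrations,
Gelfand-Kirillov dimension, return functions and filter dimensions (V. Bavula,
"Filter dimension"), and the Rentschler–Gabriel (left) Krull dimension via deviation. -/

open Filter

noncomputable section

def sandw (K : Type) [Field K] {A : Type} [Ring A] [Algebra K A] (V : Submodule K A)
    (n : ℕ) (a : A) : Submodule K A :=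
  Submodule.span K
      {x : A | ∃ u ∈ (V ^ n : Submodule K A), ∃ w ∈ (V ^ n : Submodule K A), x = u * a * w}

section aux
open TensorProduct
variable {K A : Type} [Field K] [Ring A] [Algebra K A] {V : Submodule K A}

lemma pow_mono_aux (h1 : (1 : A) ∈ V) {m n : ℕ} (h : m ≤ n) : V ^ m ≤ V ^ n :=
  pow_le_pow_right₀ (Submodule.one_le.mpr h1) h

lemma sandw_mono (h1 : (1 : A) ∈ V) {m n : ℕ} (h : m ≤ n) (a : A) :
    sandw K V m a ≤ sandw K V n a := by
  apply Submodule.span_mono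
  rintro x ⟨u, hu, w, hw, rfl⟩
  exact ⟨u, pow_mono_aux h1 h hu, w, pow_mono_aux h1 h hw, rfl⟩

lemma mul_sandw (h1 : (1 : A) ∈ V) {m n : ℕ} {z a x : A} (hz : z ∈ V ^ m)
    (hx : x ∈ sandw K V n a) : z * x ∈ sandw K V (m + n) a := by
  unfold sandw at hx
  induction hx using Submodule.span_induction with
  | mem x hx =>
    obtain ⟨u, hu, w, hw, rfl⟩ := hx
    apply Submodule.subset_span
    refine ⟨z * u, ?_, w, pow_mono_aux h1 (by omega) hw, by simp [mul_assoc]⟩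
    rw [pow_add]; exact Submodule.mul_mem_mul hz hu
  | zero => simp
  | add x y _ _ hx hy => rw [mul_add]; exact add_mem hx hy
  | smul c x _ hx => rw [mul_smul_comm]; exact Submodule.smul_mem _ _ hx

lemma exists_pow_mem (hV : IsStdFilt K A V) (x : A) : ∃ n, x ∈ V ^ n := by
  have hx : x ∈ Algebra.adjoin K (V : Set A) := by rw [hV.gen]; trivial
  induction hx using Algebra.adjoin_induction with
  | mem x hx => exact ⟨1, by simpa using hx⟩
  | algebraMap r => exact ⟨0, by rw [pow_zero]; exact Submodule.algebraMap_mem r⟩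
  | add x y _ _ hx hy =>
    obtain ⟨m, hm⟩ := hx
    obtain ⟨n, hn⟩ := hy
    exact ⟨m + n, add_mem (pow_mono_aux hV.one_mem (by omega) hm)
      (pow_mono_aux hV.one_mem (by omega) hn)⟩
  | mul x y _ _ hx hy =>
    obtain ⟨m, hm⟩ := hx
    obtain ⟨n, hn⟩ := hy
    exact ⟨m + n, by rw [pow_add]; exact Submodule.mul_mem_mul hm hn⟩

lemma exists_fg_le_pow (hV : IsStdFilt K A V) (W : Submodule K A) (hW : W.FG) :
    ∃ n, W ≤ V ^ n := by
  obtain ⟨s, rfl⟩ := hW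
  choose f hf using exists_pow_mem hV
  refine ⟨s.sup f, Submodule.span_le.mpr fun x hx => ?_⟩
  exact pow_mono_aux hV.one_mem (Finset.le_sup (f := f) hx) (hf x)

lemma tensor_sandw (hV : IsStdFilt K A V) (t : A ⊗[K] Aᵐᵒᵖ) :
    ∃ n, ∀ a, AlgHom.mulLeftRight K A t a ∈ sandw K V n a := by
  induction t using TensorProduct.induction_on with
  | zero => exact ⟨0, fun a => by simp⟩
  | tmul x y =>
    obtain ⟨m, hm⟩ := exists_pow_mem hV x
    obtain ⟨n, hn⟩ := exists_pow_mem hV y.unop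
    refine ⟨m + n, fun a => Submodule.subset_span ⟨x, pow_mono_aux hV.one_mem (by omega) hm,
      y.unop, pow_mono_aux hV.one_mem (by omega) hn, ?_⟩⟩
    rw [AlgHom.mulLeftRight_apply]
  | add x y hx hy =>
    obtain ⟨m, hm⟩ := hx
    obtain ⟨n, hn⟩ := hy
    refine ⟨m + n, fun a => ?_⟩
    rw [map_add]
    exact add_mem (sandw_mono hV.one_mem (by omega) a (hm a))
      (sandw_mono hV.one_mem (by omega) a (hn a))

lemma density_aux [IsSimpleRing A] (f : A →ₗ[K] A)
    (hf : ∀ z : A, (∀ y, z * y = y * z) → ∀ x, f (z * x) = z * f x) (s : Finset A) :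
    ∃ t : A ⊗[K] Aᵐᵒᵖ, ∀ m ∈ s, f m = AlgHom.mulLeftRight K A t m := by
  letI inst : Module (A ⊗[K] Aᵐᵒᵖ) A := TensorProduct.Algebra.module
  have hsm : ∀ (t : A ⊗[K] Aᵐᵒᵖ) (x : A), t • x = AlgHom.mulLeftRight K A t x := fun t x => rfl
  have hsm2 : ∀ (u v x : A), (u ⊗ₜ[K] MulOpposite.op v) • x = u * x * v := fun u v x => by
    rw [hsm, AlgHom.mulLeftRight_apply]; rfl
  haveI : IsSimpleModule (A ⊗[K] Aᵐᵒᵖ) A := by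
    rw [isSimpleModule_iff_toSpanSingleton_surjective]
    refine ⟨inferInstance, fun m hm x => ?_⟩
    let S := LinearMap.range (LinearMap.toSpanSingleton (A ⊗[K] Aᵐᵒᵖ) A m)
    let I : TwoSidedIdeal A := TwoSidedIdeal.mk' (S : Set A) S.zero_mem
      (fun h h' => S.add_mem h h') (fun h => S.neg_mem h)
      (fun {a b} h => by
        have := S.smul_mem (a ⊗ₜ[K] MulOpposite.op 1) h
        rw [hsm2] at this; simpa using this)
      (fun {a b} h => by
        have := S.smul_mem (1 ⊗ₜ[K] MulOpposite.op b) h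
        rw [hsm2] at this; simpa using this)
    have hI : ∀ y, y ∈ I ↔ y ∈ S := fun y => by simp [I]
    have hmI : m ∈ I := (hI m).2 ⟨1, by simp⟩
    rcases eq_bot_or_eq_top I with h | h
    · rw [h] at hmI
      exact absurd ((TwoSidedIdeal.mem_bot A).1 hmI) hm
    · have : x ∈ I := by rw [h]; trivial
      exact (hI x).1 this
  let g : Module.End (Module.End (A ⊗[K] Aᵐᵒᵖ) A) A :=
    { toFun := f
      map_add' := fun x y => map_add f x y
      map_smul' := fun φ x => by
        have hl : ∀ x y, φ (x * y) = x * φ y := fun x y => by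
          have := φ.map_smul (x ⊗ₜ[K] MulOpposite.op 1) y
          rw [hsm2, hsm2] at this; simpa using this
        have hr : ∀ x y, φ (x * y) = φ x * y := fun x y => by
          have := φ.map_smul (1 ⊗ₜ[K] MulOpposite.op y) x
          rw [hsm2, hsm2] at this; simpa using this
        have h1 : ∀ x, φ x = φ 1 * x := fun x => by rw [← hr, one_mul]
        simp only [Module.End.smul_def, RingHom.id_apply]
        rw [h1, h1 (f x)]
        refine hf _ (fun y => ?_) x
        rw [← hl, ← hr, one_mul, mul_one] }
  obtain ⟨t, ht⟩ := jacobson_density g s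
  exact ⟨t, fun m hm => ht m hm⟩

lemma core_aux [IsSimpleRing A] {Z : Type} [Field Z] [Algebra K Z] [Algebra Z A]
    [IsScalarTower K Z A] [Algebra.IsAlgebraic K Z]
    (hZ : ∀ z : A, (∀ y, z * y = y * z) → ∃ c : Z, algebraMap Z A c = z)
    (hV : IsStdFilt K A V) (i : ℕ) :
    ∃ n, ∀ a ∈ V ^ i, a ≠ 0 → (1 : A) ∈ sandw K V n a := by
  classical
  have hfg : (V ^ i).FG := by
    haveI := hV.fin
    exact Submodule.FG.pow (Module.Finite.iff_fg.mp hV.fin) i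
  obtain ⟨s, hs⟩ := hfg
  let b := Module.Basis.ofVectorSpace Z A
  let T := s.biUnion fun m => (b.repr m).support
  have hT : ∀ a ∈ V ^ i, ∀ k, k ∉ T → b.coord k a = 0 := by
    intro a ha k hk
    rw [← hs] at ha
    have : Submodule.span K (s : Set A) ≤ LinearMap.ker ((b.coord k).restrictScalars K) := by
      rw [Submodule.span_le]
      intro m hm
      by_contra hne
      apply hk
      simp only [T, Finset.mem_biUnion, Finsupp.mem_support_iff]
      exact ⟨m, hm, hne⟩
    exact this ha
  have hθ : ∀ k, ∃ n, ∀ a ∈ V ^ i, algebraMap Z A (b.coord k a) ∈ sandw K V n a := by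
    intro k
    let f : A →ₗ[K] A :=
      ((Algebra.linearMap Z A).restrictScalars K) ∘ₗ ((b.coord k).restrictScalars K)
    obtain ⟨t, ht⟩ := density_aux f (by
      intro z hz x
      obtain ⟨c, rfl⟩ := hZ z hz
      change algebraMap Z A (b.coord k _) = _ * algebraMap Z A (b.coord k x)
      rw [← Algebra.smul_def, map_smul, smul_eq_mul, map_mul]) s
    obtain ⟨n, hn⟩ := tensor_sandw hV t
    refine ⟨n, fun a ha => ?_⟩
    have : Set.EqOn f (AlgHom.mulLeftRight K A t) (Submodule.span K (s : Set A)) :=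
      LinearMap.eqOn_span (fun m hm => ht m hm)
    rw [hs] at this
    have h2 : algebraMap Z A (b.coord k a) = AlgHom.mulLeftRight K A t a := this ha
    rw [h2]
    exact hn a
  choose N hN using hθ
  let C : Subalgebra K Z :=
    Algebra.adjoin K ((T ×ˢ s).image fun p => b.coord p.1 p.2 : Finset Z)
  have hC : C.toSubmodule.FG := fg_adjoin_of_finite (Finset.finite_toSet _)
    (fun x _ => (Algebra.IsAlgebraic.isAlgebraic (R := K) x).isIntegral)
  have hCmem : ∀ a ∈ V ^ i, ∀ k ∈ T, b.coord k a ∈ C := by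
    intro a ha k hk
    rw [← hs] at ha
    have : Submodule.span K (s : Set A) ≤
        C.toSubmodule.comap ((b.coord k).restrictScalars K) := by
      rw [Submodule.span_le]
      intro m hm
      apply Algebra.subset_adjoin
      simp only [Finset.coe_image, Set.mem_image]
      exact ⟨(k, m), by simpa using ⟨hk, hm⟩, rfl⟩
    exact this ha
  obtain ⟨m, hm⟩ := exists_fg_le_pow hV
    (C.toSubmodule.map ((Algebra.linearMap Z A).restrictScalars K)) (hC.map _)
  refine ⟨m + T.sup N, fun a ha ha0 => ?_⟩
  obtain ⟨k, hk⟩ : ∃ k, b.coord k a ≠ 0 := by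
    by_contra! h
    exact ha0 (b.forall_coord_eq_zero_iff.mp h)
  have hkT : k ∈ T := by
    by_contra h
    exact hk (hT a ha k h)
  have hinv : (b.coord k a)⁻¹ ∈ C :=
    C.inv_mem_of_algebraic (x := ⟨_, hCmem a ha k hkT⟩)
      (Algebra.IsAlgebraic.isAlgebraic (R := K) (b.coord k a))
  have h1 := mul_sandw hV.one_mem (hm ⟨_, hinv, rfl⟩)
    (sandw_mono hV.one_mem (Finset.le_sup (f := N) hkT) a (hN k a ha))
  have h2 : (algebraMap Z A (b.coord k a)⁻¹) * algebraMap Z A (b.coord k a) = 1 := by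
    rw [← map_mul, inv_mul_cancel₀ hk, map_one]
  rw [← h2]
  exact h1

lemma core_aux2 [IsSimpleRing A] {Z : Type} [CommRing Z] (hF : IsField Z) [Algebra K Z]
    (φ : Z →ₐ[K] A) (halg : ∀ c, IsAlgebraic K (φ c)) (hφ : ∀ c x, φ c * x = x * φ c)
    (hZ : ∀ z : A, (∀ y, z * y = y * z) → ∃ c : Z, φ c = z)
    (hV : IsStdFilt K A V) (i : ℕ) :
    ∃ n, ∀ a ∈ V ^ i, a ≠ 0 → (1 : A) ∈ sandw K V n a := by
  let _ : Field Z := hF.toField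
  let _ : Algebra Z A := RingHom.toAlgebra' φ.toRingHom hφ
  have : IsScalarTower K Z A := IsScalarTower.of_algebraMap_eq fun r => (φ.commutes r).symm
  have : Algebra.IsAlgebraic K Z :=
    ⟨fun c => (isAlgebraic_algHom_iff φ φ.toRingHom.injective).mp (halg c)⟩
  exact core_aux hZ hV i

end aux

/-- Let `A` be a simple finitely generated `K`-algebra whose centre `Z(A)` is an algebraic
field extension of `K`, and let `F = {A_i = V ^ i}` be a standard finite-dimensional
filtration of `A`. Then `λ_F(i) ≤ ν_F(i) < ∞` for all `i ≥ 0`. -/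
theorem lam_le_nu_and_nu_lt_top
    (K A : Type) [Field K] [Ring A] [Algebra K A] [IsSimpleRing A]
    [Algebra.IsAlgebraic K ↥(Subalgebra.center K A)]
    (V : Submodule K A) (hV : IsStdFilt K A V) (i : ℕ) :
    lamFn K V i ≤ nuFn K V i ∧ nuFn K V i < ⊤ := by
  constructor
  · apply sInf_le_sInf
    rintro j ⟨n, rfl, h⟩
    refine ⟨n, rfl, fun a ha ha0 => ?_⟩
    have h1 := h a ha ha0
    have : Submodule.span K
      {x : A | ∃ u ∈ (V ^ n : Submodule K A), ∃ w ∈ (V ^ n : Submodule K A), x = u * a * w} ≤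
      (Submodule.span A
        {x : A | ∃ w ∈ (V ^ n : Submodule K A), x = a * w}).restrictScalars K := by
      rw [Submodule.span_le]
      rintro x ⟨u, -, w, hw, rfl⟩
      rw [mul_assoc]
      exact Submodule.smul_mem _ u (Submodule.subset_span ⟨w, hw, rfl⟩)
    exact this h1
  · have hF : IsField ↥(Subalgebra.center K A) := IsSimpleRing.isField_center A
    obtain ⟨n, hn⟩ := core_aux2 hF (Subalgebra.center K A).val
      (fun c => (isAlgebraic_algHom_iff (Subalgebra.center K A).val
        Subtype.val_injective).mpr (Algebra.IsAlgebraic.isAlgebraic c))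
      (fun c x => (Subalgebra.mem_center_iff.mp c.2 x).symm) (fun z hz =>
      ⟨⟨z, Subalgebra.mem_center_iff.mpr fun y => (hz y).symm⟩, rfl⟩) hV i
    exact lt_of_le_of_lt (sInf_le ⟨n, rfl, hn⟩) (ENat.coe_lt_top n)

end
end
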